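/- The generalized eigenspace G(F, λ₀) of a holomorphic Fredholm index-zero operator function F at an eigenvalue λ₀ (the closed linear hull of all generalized eigenelements, i.e., all elements of all Jordan chains at λ₀) is finite-dimensional, provided the resolvent set of F is nonempty. -/

import Mathlib

section

variable {V : Type*} [NormedAddCommGroup V] [NormedSpace ℂ V]

/-- A bounded operator is Fredholm of index zero. -/
def IsFredholmIndexZero (F : V →L[ℂ] V) : Prop :=
  IsClosed (LinearMap.range (F : V →ₗ[ℂ] V) : Set V) ∧
  FiniteDimensional ℂ (LinearMap.ker (F : V →ₗ[ℂ] V)) ∧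
  FiniteDimensional ℂ (V ⧸ LinearMap.range (F : V →ₗ[ℂ] V)) ∧
  Module.finrank ℂ (LinearMap.ker (F : V →ₗ[ℂ] V)) =
    Module.finrank ℂ (V ⧸ LinearMap.range (F : V →ₗ[ℂ] V))

/-- `x 0, …, x k` is a Jordan chain of `F` at `λ₀`. -/
def IsJordanChain (F : ℂ → V →L[ℂ] V) (lam₀ : ℂ) (x : ℕ → V) (k : ℕ) : Prop :=
  ∀ j ≤ k, ∑ i ∈ Finset.range (j + 1),
    ((i.factorial : ℂ)⁻¹) • (iteratedDeriv i F lam₀) (x (j - i)) = 0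

/-- `g` is a generalized eigenelement of `F` at `λ₀`: a member of some Jordan chain
starting at an eigenelement. -/
def IsGeneralizedEigenelement (F : ℂ → V →L[ℂ] V) (lam₀ : ℂ) (g : V) : Prop :=
  ∃ (k : ℕ) (x : ℕ → V), x 0 ≠ 0 ∧ IsJordanChain F lam₀ x k ∧ ∃ j ≤ k, x j = g

open Filter Topology Asymptotics

theorem aux_fred [CompleteSpace V] (F : V →L[ℂ] V) (h : IsFredholmIndexZero F) :
    ∃ (n : ℕ) (B : (Fin n → ℂ) →L[ℂ] V) (C : V →L[ℂ] (Fin n → ℂ)), IsUnit (F + B.comp C) := by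
  obtain ⟨hc, h1, h2, h3⟩ := h
  set N := LinearMap.ker (F : V →ₗ[ℂ] V) with hN
  set R := LinearMap.range (F : V →ₗ[ℂ] V) with hR
  obtain ⟨P, hP⟩ := Submodule.ClosedComplemented.of_finiteDimensional (𝕜 := ℂ) N
  let e : N ≃ₗ[ℂ] (V ⧸ R) := LinearEquiv.ofFinrankEq _ _ h3
  obtain ⟨s, hs⟩ := R.mkQ.exists_rightInverse_of_surjective (Submodule.range_mkQ R)
  let b : N ≃ₗ[ℂ] (Fin (Module.finrank ℂ N) → ℂ) := (Module.finBasis ℂ N).equivFun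
  let B : (Fin (Module.finrank ℂ N) → ℂ) →L[ℂ] V :=
    LinearMap.toContinuousLinearMap (s ∘ₗ e.toLinearMap ∘ₗ b.symm.toLinearMap)
  let C : V →L[ℂ] (Fin (Module.finrank ℂ N) → ℂ) :=
    (LinearMap.toContinuousLinearMap b.toLinearMap).comp P
  refine ⟨_, B, C, ?_⟩
  have hs' : ∀ q, R.mkQ (s q) = q := fun q => LinearMap.congr_fun hs q
  have hBC : ∀ x, (F + B.comp C) x = F x + s (e (P x)) := by
    intro x; simp [B, C]
  have hFR : ∀ x, R.mkQ (F x) = 0 := by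
    intro x
    simp only [Submodule.mkQ_apply, Submodule.Quotient.mk_eq_zero]
    exact ⟨x, rfl⟩
  rw [ContinuousLinearMap.isUnit_iff_bijective]
  constructor
  · rw [injective_iff_map_eq_zero]
    intro x hx
    rw [hBC] at hx
    have h4 : e (P x) = 0 := by
      have := congrArg R.mkQ hx
      rwa [map_add, hFR, hs', zero_add, map_zero] at this
    have h5 : P x = 0 := by simpa using h4
    rw [h4] at hx
    have h6 : x ∈ N := by
      rw [hN, LinearMap.mem_ker]; simpa using hx
    have := hP ⟨x, h6⟩
    simp only [h5] at this
    exact (congrArg Subtype.val this).symm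
  · intro y
    let u := e.symm (R.mkQ y)
    have h4 : y - s (e u) ∈ R := by
      have h5 : R.mkQ (y - s (e u)) = 0 := by
        rw [map_sub, hs']
        simp [u]
      rwa [Submodule.mkQ_apply, Submodule.Quotient.mk_eq_zero] at h5
    obtain ⟨w, hw⟩ := h4
    have hw' : F w = y - s (e u) := hw
    have hk : ∀ v : N, F v = 0 := fun v => v.2
    refine ⟨w - (P w : V) + u, ?_⟩
    rw [hBC]
    simp only [map_add, map_sub, hk, hP, hw']
    simp

/-- local structure -/
theorem aux_local [CompleteSpace V] (F : ℂ → V →L[ℂ] V) (μ : ℂ) (hF : AnalyticAt ℂ F μ)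
    (h : IsFredholmIndexZero (F μ)) :
    ∃ (d : ℂ → ℂ) (G : ℂ → V →L[ℂ] V), AnalyticAt ℂ d μ ∧ ContinuousAt G μ ∧
      (∀ᶠ z in 𝓝 μ, G z * F z = d z • 1 ∧ F z * G z = d z • 1 ∧ (IsUnit (F z) → d z ≠ 0)) := by
  obtain ⟨n, B, C, hu⟩ := aux_fred _ h
  let E : ℂ → V →L[ℂ] V := fun z => F z + B.comp C
  have hE : AnalyticAt ℂ E μ := hF.add analyticAt_const
  let R : ℂ → V →L[ℂ] V := fun z => Ring.inverse (E z)
  have hR : AnalyticAt ℂ R μ := by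
    have h1 : AnalyticAt ℂ Ring.inverse (E μ) := by
      obtain ⟨u, hu'⟩ := hu
      have := analyticAt_inverse (𝕜 := ℂ) u
      rw [hu'] at this
      exact this
    exact h1.comp hE
  let T : ℂ → Matrix (Fin n) (Fin n) ℂ := fun z =>
    1 - LinearMap.toMatrix' ((C.comp ((R z).comp B) : (Fin n → ℂ) →L[ℂ] (Fin n → ℂ)) : (Fin n → ℂ) →ₗ[ℂ] (Fin n → ℂ))
  have hTv : ∀ z v, (T z).mulVec v = v - C (R z (B v)) := by
    intro z v
    simp [T, Matrix.sub_mulVec, LinearMap.toMatrix'_mulVec]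
  have hTij : ∀ i j, AnalyticAt ℂ (fun z => T z i j) μ := by
    intro i j
    have h2 : (fun z => T z i j) = fun z => (1 : Matrix (Fin n) (Fin n) ℂ) i j -
        (((ContinuousLinearMap.proj i).comp C).comp
          (ContinuousLinearMap.apply ℂ V (B (Pi.single j 1)))) (R z) := by
      ext z
      simp [T, LinearMap.toMatrix'_apply]
    rw [h2]
    exact analyticAt_const.sub ((ContinuousLinearMap.analyticAt _ _).comp hR)
  have hTc : ContinuousAt T μ := by
    refine continuousAt_pi.2 fun i => continuousAt_pi.2 fun j => (hTij i j).continuousAt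
  let A : ℂ → (Fin n → ℂ) →L[ℂ] (Fin n → ℂ) := fun z =>
    LinearMap.toContinuousLinearMap (Matrix.toLin' (T z).adjugate)
  have hA : ContinuousAt A μ := by
    have h3 : Continuous fun M : Matrix (Fin n) (Fin n) ℂ =>
        LinearMap.toContinuousLinearMap (Matrix.toLin' M) := by
      exact LinearMap.continuous_of_finiteDimensional (𝕜 := ℂ)
        ({ toFun := fun M => LinearMap.toContinuousLinearMap (Matrix.toLin' M)
           map_add' := fun _ _ => by simp only [map_add]
           map_smul' := fun _ _ => by simp only [map_smul, RingHom.id_apply] } :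
          Matrix (Fin n) (Fin n) ℂ →ₗ[ℂ] ((Fin n → ℂ) →L[ℂ] (Fin n → ℂ)))
    exact (h3.comp (Continuous.matrix_adjugate continuous_id)).continuousAt.comp hTc
  let d : ℂ → ℂ := fun z => (T z).det
  have hAv : ∀ z v, A z v = (T z).adjugate.mulVec v := fun z v => by simp [A]
  have hA1 : ∀ z v, A z v - A z (C (R z (B v))) = d z • v := by
    intro z v
    rw [← map_sub, ← hTv, hAv, Matrix.mulVec_mulVec, Matrix.adjugate_mul]
    simp [d, Matrix.smul_mulVec]
  have hA2 : ∀ z v, A z v - C (R z (B (A z v))) = d z • v := by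
    intro z v
    rw [← hTv, hAv, Matrix.mulVec_mulVec, Matrix.mul_adjugate]
    simp [d, Matrix.smul_mulVec]
  refine ⟨d, fun z => d z • R z + (((R z).comp B).comp (A z)).comp (C.comp (R z)), ?_, ?_, ?_⟩
  · simp only [d, Matrix.det_apply']
    exact Finset.analyticAt_fun_sum _ fun σ _ =>
      analyticAt_const.mul (Finset.analyticAt_fun_prod _ fun i _ => hTij _ _)
  · have hdc : ContinuousAt d μ :=
      (Continuous.matrix_det continuous_id).continuousAt.comp hTc
    have hRc := hR.continuousAt
    exact (hdc.smul hRc).add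
      (((hRc.clm_comp continuousAt_const).clm_comp hA).clm_comp (continuousAt_const.clm_comp hRc))
  · have hEu : ∀ᶠ z in 𝓝 μ, IsUnit (E z) := by
      exact hE.continuousAt.eventually (Units.isOpen.mem_nhds hu)
    filter_upwards [hEu] with z hz
    have hRE : ∀ v, R z (F z v) = v - R z (B (C v)) := by
      intro v
      have : (R z * E z) v = v := by simp [R, Ring.inverse_mul_cancel _ hz]
      have h2 : R z (F z v + B (C v)) = v := this
      rw [map_add] at h2
      exact eq_sub_of_add_eq h2
    have hER : ∀ v, F z (R z v) = v - B (C (R z v)) := by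
      intro v
      have : (E z * R z) v = v := by simp [R, Ring.mul_inverse_cancel _ hz]
      have h2 : F z (R z v) + B (C (R z v)) = v := this
      exact eq_sub_of_add_eq h2
    refine ⟨?_, ?_, ?_⟩
    · ext v
      have := congrArg (fun t => R z (B t)) (hA1 z (C v))
      simp only [map_sub, map_smul] at this
      simp [hRE, smul_sub, ← this]
    · ext v
      have := congrArg B (hA2 z (C (R z v)))
      simp only [map_sub, map_smul] at this
      simp [hER, smul_sub, ← this]
    · intro hFu hd
      obtain ⟨v, hv, hv2⟩ := Matrix.exists_mulVec_eq_zero_iff.2 hd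
      rw [hTv, sub_eq_zero] at hv2
      have h1 : F z (R z (B v)) = 0 := by rw [hER, ← hv2, sub_self]
      rw [ContinuousLinearMap.isUnit_iff_bijective] at hFu
      have h2 : R z (B v) = 0 := hFu.1 (by rw [h1, map_zero])
      rw [h2, map_zero] at hv2
      exact hv hv2

theorem aux_fd (F : ℂ → V →L[ℂ] V) (l : ℂ)
    (hk : FiniteDimensional ℂ (LinearMap.ker (F l : V →ₗ[ℂ] V))) (m : ℕ) :
    ∃ U : Submodule ℂ V, FiniteDimensional ℂ U ∧ ∀ k x, IsJordanChain F l x k →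
      ∀ j ≤ m, j ≤ k → x j ∈ U := by
  induction m with
  | zero =>
    refine ⟨_, hk, fun k x hx j hj hjk => ?_⟩
    obtain rfl : j = 0 := by omega
    have := hx 0 (by omega)
    simpa using this
  | succ m ih =>
    obtain ⟨U, hU, h⟩ := ih
    let W : Submodule ℂ V := ⨆ i : Fin (m + 2), U.map ((iteratedDeriv i F l : V →L[ℂ] V) : V →ₗ[ℂ] V)
    have : FiniteDimensional ℂ W := by infer_instance
    refine ⟨U ⊔ W.comap (F l : V →ₗ[ℂ] V), ?_, ?_⟩
    · have : FiniteDimensional ℂ (W.comap (F l : V →ₗ[ℂ] V)) := by infer_instance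
      infer_instance
    · intro k x hx j hj hjk
      rcases Nat.lt_or_ge m j with hlt | hle
      · obtain rfl : j = m + 1 := by omega
        refine Submodule.mem_sup_right ?_
        have h1 := hx (m + 1) hjk
        rw [Finset.sum_range_succ'] at h1
        simp only [Nat.factorial_zero, Nat.cast_one, inv_one, one_smul, iteratedDeriv_zero,
          Nat.sub_zero] at h1
        rw [Submodule.mem_comap]
        change F l (x (m + 1)) ∈ W
        rw [eq_neg_of_add_eq_zero_right h1]
        refine W.neg_mem (W.sum_mem fun i hi => W.smul_mem _ ?_)
        rw [Finset.mem_range] at hi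
        refine Submodule.mem_iSup_of_mem (⟨i + 1, by omega⟩ : Fin (m + 2)) ?_
        exact ⟨x (m + 1 - (i + 1)), h k x hx _ (by omega) (by omega), rfl⟩
      · exact Submodule.mem_sup_left (h k x hx j hle hjk)

theorem aux_taylor (F : ℂ → V →L[ℂ] V) (l : ℂ) (hF : AnalyticAt ℂ F l) [CompleteSpace V] (n : ℕ) :
    (fun z => F (l + z) - ∑ i ∈ Finset.range n, z ^ i • ((i.factorial : ℂ)⁻¹) • iteratedDeriv i F l)
      =O[𝓝 0] fun z => z ^ n := by
  obtain ⟨p, hp⟩ := hF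
  have h := hp.isBigO_sub_partialSum_pow n
  have h2 : (fun z : ℂ => ‖z‖ ^ n) = fun z => ‖z ^ n‖ := by ext; simp
  rw [h2, isBigO_norm_right] at h
  refine h.congr_left fun z => ?_
  congr 1
  symm
  change _ = ∑ i ∈ Finset.range n, p i fun _ => z
  refine Finset.sum_congr rfl fun i _ => ?_
  obtain ⟨r, hr⟩ := hp
  have h4 := hr.factorial_smul 1 i
  rw [← iteratedDeriv_eq_iteratedFDeriv] at h4
  rw [← h4]
  have h5 : (i.factorial : ℂ) ≠ 0 := by exact_mod_cast i.factorial_ne_zero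
  rw [← Nat.cast_smul_eq_nsmul ℂ, inv_smul_smul₀ h5]
  simp

theorem aux_chain (F : ℂ → V →L[ℂ] V) (l : ℂ) (hF : AnalyticAt ℂ F l) [CompleteSpace V]
    (x : ℕ → V) (k : ℕ) (hx : IsJordanChain F l x k) :
    (fun z => F (l + z) (∑ j ∈ Finset.range (k + 1), z ^ j • x j)) =O[𝓝 0] fun z => z ^ (k + 1) := by
  have key : ∀ z : ℂ, F (l + z) (∑ j ∈ Finset.range (k + 1), z ^ j • x j) =
      ∑ j ∈ Finset.range (k + 1), z ^ j • (F (l + z) - ∑ i ∈ Finset.range (k + 1 - j),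
        z ^ i • ((i.factorial : ℂ)⁻¹) • iteratedDeriv i F l) (x j) := by
    intro z
    have h1 : ∑ j ∈ Finset.range (k + 1), ∑ i ∈ Finset.range (k + 1 - j),
        z ^ (i + j) • ((i.factorial : ℂ)⁻¹) • iteratedDeriv i F l (x j) = 0 := by
      rw [← Finset.sum_range_diag_flip (k + 1) (fun j i =>
        z ^ (i + j) • ((i.factorial : ℂ)⁻¹) • iteratedDeriv i F l (x j))]
      refine Finset.sum_eq_zero fun m hm => ?_
      rw [Finset.mem_range] at hm
      rw [← Finset.sum_range_reflect]
      have h2 := hx m (by omega)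
      rw [← smul_zero (z ^ m), ← h2, Finset.smul_sum]
      refine Finset.sum_congr rfl fun i hi => ?_
      rw [Finset.mem_range] at hi
      have e1 : m + 1 - 1 - i = m - i := by omega
      have e2 : m - (m - i) = i := by omega
      have e3 : i + (m - i) = m := by omega
      rw [e1, e2, e3]
    simp only [sub_apply, sum_apply, smul_sub,
      Finset.sum_sub_distrib, smul_apply, Finset.smul_sum, smul_smul, map_sum,
      map_smul] at h1 ⊢
    rw [eq_comm, sub_eq_self, ← h1]
    refine Finset.sum_congr rfl fun j _ => Finset.sum_congr rfl fun i _ => ?_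
    congr 1; ring
  simp only [key]
  refine IsBigO.fun_sum (fun j hj => ?_)
  rw [Finset.mem_range] at hj
  have h1 := aux_taylor F l hF (k + 1 - j)
  have h2 : (fun z : ℂ => (F (l + z) - ∑ i ∈ Finset.range (k + 1 - j),
        z ^ i • ((i.factorial : ℂ)⁻¹) • iteratedDeriv i F l) (x j)) =O[𝓝 0]
        fun z : ℂ => z ^ (k + 1 - j) := by
    refine IsBigO.trans (IsBigO.of_bound ‖x j‖ (Eventually.of_forall fun z => ?_)) h1
    rw [mul_comm]
    exact ContinuousLinearMap.le_opNorm _ _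
  have h3 := (isBigO_refl (fun z : ℂ => z ^ j) (𝓝 0)).smul h2
  refine h3.congr_right fun z => ?_
  rw [smul_eq_mul, ← pow_add]; congr 1; omega


theorem aux_dense [CompleteSpace V]
    (Ω : Set ℂ) (hΩconn : IsConnected Ω)
    (F : ℂ → V →L[ℂ] V) (hhol : AnalyticOnNhd ℂ F Ω)
    (hFred : ∀ lam ∈ Ω, IsFredholmIndexZero (F lam))
    (l : ℂ) (hl : l ∈ Ω) (hlu : IsUnit (F l)) : Ω ⊆ closure {z | IsUnit (F z)} := by
  refine Set.Subset.trans ?_ (interior_subset (s := closure {z | IsUnit (F z)}))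
  refine hΩconn.isPreconnected.subset_of_closure_inter_subset isOpen_interior ⟨l, hl, ?_⟩ ?_
  · refine interior_mono subset_closure ?_
    rw [mem_interior_iff_mem_nhds]
    exact (hhol l hl).continuousAt.eventually (Units.isOpen.mem_nhds hlu)
  · rintro z ⟨hz, hzΩ⟩
    have hz' : z ∈ closure {z | IsUnit (F z)} :=
      closure_minimal interior_subset isClosed_closure hz
    obtain ⟨d, G, hd, -, hG⟩ := aux_local F z (hhol z hzΩ) (hFred z hzΩ)
    rw [mem_interior_iff_mem_nhds]
    rcases hd.eventually_eq_zero_or_eventually_ne_zero with h0 | h0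
    · exfalso
      rw [mem_closure_iff_frequently] at hz'
      refine hz' ?_
      filter_upwards [h0, hG] with w h1 h2 h3
      exact h2.2.2 h3 h1
    · rw [eventually_nhdsWithin_iff] at h0
      filter_upwards [h0, hG] with w h1 h2
      by_cases hw : w = z
      · rw [hw]; exact hz'
      · refine subset_closure ?_
        have hdw := h1 hw
        change IsUnit (F w)
        refine isUnit_iff_exists.2 ⟨(d w)⁻¹ • G w, ?_, ?_⟩
        · rw [mul_smul_comm, h2.2.1, smul_smul, inv_mul_cancel₀ hdw, one_smul]
        · rw [smul_mul_assoc, h2.1, smul_smul, inv_mul_cancel₀ hdw, one_smul]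

/-- The generalized eigenspace `G(F, λ₀)` — the closed linear hull of all
generalized eigenelements at an eigenvalue `λ₀` of a holomorphic Fredholm index-zero
operator function with nonempty resolvent set — is finite-dimensional. -/
theorem stmt15 [CompleteSpace V]
    (Ω : Set ℂ) (hΩo : IsOpen Ω) (hΩconn : IsConnected Ω)
    (F : ℂ → V →L[ℂ] V) (hhol : AnalyticOnNhd ℂ F Ω)
    (hFred : ∀ lam ∈ Ω, IsFredholmIndexZero (F lam))
    (hres : ∃ lam ∈ Ω, ∃ G : V →L[ℂ] V,
      G.comp (F lam) = ContinuousLinearMap.id ℂ V ∧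
      (F lam).comp G = ContinuousLinearMap.id ℂ V)
    (lam₀ : ℂ) (hlam₀ : lam₀ ∈ Ω)
    (heig : ∃ x : V, x ≠ 0 ∧ (F lam₀) x = 0) :
    FiniteDimensional ℂ
      ((Submodule.span ℂ {g : V | IsGeneralizedEigenelement F lam₀ g}).topologicalClosure) := by
  obtain ⟨l, hl, G₁, hG1, hG2⟩ := hres
  have hdense := aux_dense Ω hΩconn F hhol hFred l hl (isUnit_iff_exists.2 ⟨G₁, hG2, hG1⟩) hlam₀
  obtain ⟨d, G, hd, hGc, hG⟩ := aux_local F lam₀ (hhol _ hlam₀) (hFred _ hlam₀)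
  have hd0 : ¬ ∀ᶠ z in 𝓝 lam₀, d z = 0 := by
    intro h0
    rw [mem_closure_iff_frequently] at hdense
    refine hdense ?_
    filter_upwards [h0, hG] with w h1 h2 h3
    exact h2.2.2 h3 h1
  obtain ⟨m, g, hg, hg0, hdg⟩ := hd.exists_eventuallyEq_pow_smul_nonzero_iff.2 hd0
  have htr : Tendsto (fun z : ℂ => lam₀ + z) (𝓝 0) (𝓝 lam₀) := by
    have : Continuous fun z : ℂ => lam₀ + z := by fun_prop
    simpa using this.tendsto 0
  have hbound : ∀ k x, x 0 ≠ 0 → IsJordanChain F lam₀ x k → k < m := by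
    intro k x hx0 hx
    by_contra hk
    push Not at hk
    have h1 := aux_chain F lam₀ (hhol _ hlam₀) x k hx
    set X : ℂ → V := fun z => ∑ j ∈ Finset.range (k + 1), z ^ j • x j with hX
    have hXc : Continuous X := by fun_prop
    have hX0 : X 0 = x 0 := by
      simp [hX, Finset.sum_range_succ']
    have h2 : (fun z => G (lam₀ + z)) =O[𝓝 0] fun _ => (1 : ℝ) :=
      (hGc.tendsto.comp htr).isBigO_one ℝ
    have h3 : (fun z => G (lam₀ + z) (F (lam₀ + z) (X z))) =O[𝓝 0] fun z : ℂ => z ^ (k + 1) := by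
      have h4 := h2.norm_norm.mul h1.norm_norm
      have h5 : (fun z => G (lam₀ + z) (F (lam₀ + z) (X z))) =O[𝓝 0]
          fun z => ‖G (lam₀ + z)‖ * ‖F (lam₀ + z) (X z)‖ :=
        IsBigO.of_norm_le fun z => (G (lam₀ + z)).le_opNorm _
      refine (h5.trans h4).trans ?_
      simp only [norm_one, one_mul]
      exact (isBigO_refl _ _).norm_left
    have h4 : (fun z : ℂ => z ^ m • (g (lam₀ + z) • X z)) =O[𝓝 0] fun z : ℂ => z ^ (k + 1) := by
      refine h3.congr' ?_ EventuallyEq.rfl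
      filter_upwards [htr.eventually hG, htr.eventually hdg] with z h5 h6
      have h7 : (G (lam₀ + z) * F (lam₀ + z)) (X z) = d (lam₀ + z) • X z := by
        rw [h5.1]; rfl
      rw [mul_apply_eq_comp] at h7
      rw [h7, h6]
      simp [smul_smul]
    have h5 : (fun z : ℂ => z ^ m • (g (lam₀ + z) • X z)) =o[𝓝 0] fun z : ℂ => z ^ m :=
      h4.trans_isLittleO (isLittleO_pow_pow (by omega))
    have h6 : (fun z : ℂ => g (lam₀ + z) • X z) =o[𝓝[≠] 0] fun z : ℂ => (1 : ℂ) := by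
      have h7 := (isBigO_refl (fun z : ℂ => (z ^ m)⁻¹) (𝓝[≠] 0)).smul_isLittleO
        (h5.mono nhdsWithin_le_nhds)
      refine h7.congr' ?_ ?_
      · filter_upwards [self_mem_nhdsWithin] with z hz
        rw [smul_smul, inv_mul_cancel₀ (pow_ne_zero _ hz), one_smul]
      · filter_upwards [self_mem_nhdsWithin] with z hz
        rw [smul_eq_mul, inv_mul_cancel₀ (pow_ne_zero _ hz)]
    rw [isLittleO_one_iff] at h6
    have h7 : Tendsto (fun z : ℂ => g (lam₀ + z) • X z) (𝓝[≠] 0) (𝓝 (g lam₀ • X 0)) :=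
      ((hg.continuousAt.tendsto.comp htr).smul (hXc.tendsto 0)).mono_left nhdsWithin_le_nhds
    have h8 := tendsto_nhds_unique h6 h7
    rw [hX0] at h8
    exact smul_ne_zero hg0 hx0 h8.symm
  obtain ⟨U, hU, hUm⟩ := aux_fd F lam₀ (hFred _ hlam₀).2.1 m
  have hle : Submodule.span ℂ {g : V | IsGeneralizedEigenelement F lam₀ g} ≤ U := by
    rw [Submodule.span_le]
    rintro _ ⟨k, x, hx0, hx, j, hj, rfl⟩
    have := hbound k x hx0 hx
    exact hUm k x hx j (by omega) hj
  have hle2 : (Submodule.span ℂ {g : V | IsGeneralizedEigenelement F lam₀ g}).topologicalClosure ≤ U :=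
    Submodule.topologicalClosure_minimal _ hle U.closed_of_finiteDimensional
  exact Submodule.finiteDimensional_of_le hle2

end
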